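/- arXiv:2009.02981 — 2 statements merged into one kernel-verified Lean document; each statement's English description precedes it below -/
import Mathlib

section
/- Let k be an algebraically closed field and let g ∈ GL₄(k) be such that rank(g − μ·1) ≥ 2 for every μ ∈ k ∖ {0}, where 1 is the identity matrix. Then there exist μ ∈ k ∖ {0}, elements a, b, c ∈ {0, 1} ⊆ k and α, β, γ ∈ k ∖ {0} satisfying: (a) if β = γ then c = 1, and (b) a ≠ 0 or b ≠ 0 or α ≠ 1 or β ≠ 1, and a matrix P ∈ GL₄(k), such that μ⁻¹·g = P·x·P⁻¹, where x is the matrix with rows (1,0,0,0), (a,α,0,0), (0,b,β,0), (0,0,c,γ). -/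
universe u

open Polynomial in
/-- **Jordan decomposition**: an endomorphism of a finite-dimensional space over an algebraically
closed field admits a basis made of Jordan chains. -/
theorem Module.End.exists_jordan_chains {k : Type u} {V : Type*} [Field k] [IsAlgClosed k] [AddCommGroup V]
    [Module k V] [FiniteDimensional k V] (T : Module.End k V) :
    ∃ (ι : Type u) (_ : Fintype ι) (l : ι → k) (e : ι → ℕ) (u : ι → ℕ → V),
      (∀ i n, T (u i n) = l i • u i n + u i (n + 1)) ∧
      (∀ i, u i (e i) = 0) ∧
      ∑ i, e i = Module.finrank k V ∧
      LinearIndependent k fun x : Σ i, Fin (e i) => u x.1 x.2 := by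
  classical
  obtain ⟨ι, _, p, hp, e, ⟨φ⟩⟩ := Module.equiv_directSum_of_isTorsion
    (Module.AEval.isTorsion_of_finiteDimensional k V T)
  have hroot (i : ι) : ∃ l : k, Associated (X - C l) (p i) := by
    obtain ⟨l, hl⟩ := IsAlgClosed.exists_root (p i)
      (fun h => by simpa [h] using IsAlgClosed.degree_eq_one_of_irreducible k (hp i))
    exact ⟨l, (irreducible_X_sub_C l).associated_of_dvd (hp i) (dvd_iff_isRoot.mpr hl)⟩
  choose l hl using hroot
  let q (i : ι) : k[X] ⧸ Ideal.span {p i ^ e i} := Ideal.Quotient.mk _ 1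
  let of := Module.AEval.of k V T
  let w (i : ι) : V := of.symm (φ.symm (DirectSum.lof k[X] ι _ i (q i)))
  have haeval (f : k[X]) (i : ι) : aeval T f (w i) =
      of.symm (φ.symm (DirectSum.lof k[X] ι _ i (Ideal.Quotient.mk _ f))) := by
    have : Ideal.Quotient.mk (Ideal.span {p i ^ e i}) f = f • q i := by
      exact (congrArg (Ideal.Quotient.mk (Ideal.span {p i ^ e i})) (mul_one f)).symm
    rw [this, map_smul, map_smul]
    exact (Module.AEval.of_symm_smul T f _).symm
  have hpow (i : ι) (n : ℕ) : (T - algebraMap k _ (l i)) ^ n = aeval T ((X - C (l i)) ^ n) := by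
    simp
  have hzero (i : ι) : ((T - algebraMap k _ (l i)) ^ e i) (w i) = 0 := by
    rw [hpow, haeval, Ideal.Quotient.eq_zero_iff_mem.mpr]
    · simp
    · exact Ideal.mem_span_singleton.mpr ((hl i).pow_pow.symm.dvd)
  have hcard : ∑ i, e i = Module.finrank k V := by
    have h1 : Module.finrank k V =
        Module.finrank k (DirectSum ι fun i => k[X] ⧸ Ideal.span {p i ^ e i}) :=
      (of.trans (φ.restrictScalars k)).finrank_eq
    have hfin (i : ι) : Module.Finite k (k[X] ⧸ Ideal.span {p i ^ e i}) :=
      (AdjoinRoot.powerBasis (pow_ne_zero (e i) (hp i).ne_zero)).finite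
    rw [h1, Module.finrank_directSum]
    refine Finset.sum_congr rfl fun i _ => ?_
    have hdeg : (p i).natDegree = 1 :=
      natDegree_eq_of_degree_eq_some (IsAlgClosed.degree_eq_one_of_irreducible k (hp i))
    rw [finrank_quotient_span_eq_natDegree, natDegree_pow, hdeg, mul_one]
  refine ⟨ι, inferInstance, l, e, fun i n => ((T - algebraMap k _ (l i)) ^ n) (w i),
    fun i n => by simp [pow_succ'], hzero, hcard, ?_⟩
  refine linearIndependent_of_top_le_span_of_card_eq_finrank ?_ (by simpa using hcard)
  set S := Submodule.span k (Set.range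
    fun x : Σ i, Fin (e i) => ((T - algebraMap k _ (l x.1)) ^ (x.2 : ℕ)) (w x.1)) with hS
  have hmem (i : ι) (n : ℕ) : ((T - algebraMap k _ (l i)) ^ n) (w i) ∈ S := by
    by_cases hn : n < e i
    · exact Submodule.subset_span ⟨⟨i, n, hn⟩, rfl⟩
    · rw [← Nat.sub_add_cancel (not_lt.mp hn), pow_add, Module.End.mul_apply, hzero, map_zero]
      exact S.zero_mem
  have hinv : S ≤ S.comap T := by
    rw [hS, Submodule.span_le]
    rintro _ ⟨⟨i, n⟩, rfl⟩
    have h := S.add_mem (hmem i (n + 1)) (S.smul_mem (l i) (hmem i n))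
    rw [pow_succ', Module.End.mul_apply] at h
    simpa using h
  have haevalmem (f : k[X]) (v : V) (hv : v ∈ S) : aeval T f v ∈ S := by
    induction f using Polynomial.induction_on generalizing v with
    | C a => simpa using S.smul_mem a hv
    | add f g hf hg => simpa using S.add_mem (hf v hv) (hg v hv)
    | monomial n a h =>
      rw [pow_succ, ← mul_assoc, map_mul, aeval_X]
      exact h _ (hinv hv)
  intro v _
  have hsum (z : DirectSum ι fun i => k[X] ⧸ Ideal.span {p i ^ e i}) : of.symm (φ.symm z) ∈ S := by
    induction z using DirectSum.induction_on with
    | zero => simp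
    | of i y =>
      obtain ⟨f, rfl⟩ := Ideal.Quotient.mk_surjective y
      exact haeval f i ▸ haevalmem f _ (by simpa using hmem i 0)
    | add y z hy hz => simpa using S.add_mem hy hz
  simpa using hsum (φ (of v))

theorem Matrix.injective_vecCons_four {α : Type*} {a b c d : α} :
    Function.Injective ![a, b, c, d] ↔
      a ≠ b ∧ a ≠ c ∧ a ≠ d ∧ b ≠ c ∧ b ≠ d ∧ c ≠ d := by
  simp only [Function.Injective, Fin.forall_fin_succ]
  simp
  grind

open Matrix in
/-- A square matrix annihilating all but one member of a basis has rank at most one. -/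
theorem Matrix.rank_le_one_of_mulVec_eq_zero {k n : Type*} [Field k] [Fintype n] [DecidableEq n]
    (M : Matrix n n k) (v : n → n → k) (hv : LinearIndependent k v) (j₀ : n)
    (h : ∀ j ≠ j₀, M *ᵥ v j = 0) : M.rank ≤ 1 := by
  have hspan := hv.span_eq_top_of_card_eq_finrank' (by simp)
  have hle : LinearMap.range M.mulVecLin ≤ Submodule.span k {M *ᵥ v j₀} := by
    rw [LinearMap.range_eq_map, ← hspan, Submodule.map_span, Submodule.span_le]
    rintro _ ⟨_, ⟨j, rfl⟩, rfl⟩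
    by_cases hj : j = j₀
    · subst hj
      exact Submodule.mem_span_singleton_self _
    · simp [h j hj]
  exact (Submodule.finrank_mono hle).trans (by simpa using finrank_span_le_card {M *ᵥ v j₀})

open Matrix in
/-- A matrix which is lower bidiagonal in some basis is, up to a scalar, conjugate to a lower
bidiagonal matrix with upper left entry `1` and the same subdiagonal. -/
theorem Matrix.exists_inv_smul_eq_conj_bidiagonal {k : Type*} [Field k]
    (M : Matrix (Fin 4) (Fin 4) k) (v : Fin 4 → Fin 4 → k) (hv : LinearIndependent k v)
    (l : Fin 4 → k) (hl : l 0 ≠ 0) (a b c : k)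
    (h0 : M *ᵥ v 0 = l 0 • v 0 + a • v 1) (h1 : M *ᵥ v 1 = l 1 • v 1 + b • v 2)
    (h2 : M *ᵥ v 2 = l 2 • v 2 + c • v 3) (h3 : M *ᵥ v 3 = l 3 • v 3) :
    ∃ P : Matrix.GeneralLinearGroup (Fin 4) k,
      (l 0)⁻¹ • M = (P : Matrix (Fin 4) (Fin 4) k) *
        !![(1 : k),0,0,0; a,(l 0)⁻¹ * l 1,0,0; 0,b,(l 0)⁻¹ * l 2,0; 0,0,c,(l 0)⁻¹ * l 3] *
        ((P⁻¹ : Matrix.GeneralLinearGroup (Fin 4) k) : Matrix (Fin 4) (Fin 4) k) := by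
  let Q : Matrix (Fin 4) (Fin 4) k := .of fun i j => (l 0)⁻¹ ^ (j : ℕ) * v j i
  have hli : LinearIndependent k Q.col := by
    convert hv.units_smul fun j => Units.mk0 (l 0)⁻¹ (inv_ne_zero hl) ^ (j : ℕ) using 1
    ext j i
    simp [Q, Units.smul_def]
  have hQ : IsUnit Q := Matrix.linearIndependent_cols_iff_isUnit.mp hli
  obtain ⟨P, hP⟩ := hQ
  refine ⟨P, ?_⟩
  have hcol (i j : Fin 4) : (((l 0)⁻¹ • M) * Q) i j = (l 0)⁻¹ ^ ((j : ℕ) + 1) * (M *ᵥ v j) i := by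
    simp only [Q, Matrix.mul_apply, Matrix.smul_apply, Matrix.of_apply, Matrix.mulVec, dotProduct,
      Finset.mul_sum, smul_eq_mul]
    exact Finset.sum_congr rfl fun _ _ => by ring
  rw [Units.eq_mul_inv_iff_mul_eq, hP]
  ext i j
  rw [hcol]
  fin_cases j <;> simp [h0, h1, h2, h3, Q, Matrix.mul_apply, Fin.sum_univ_four] <;> field_simp


set_option maxHeartbeats 1000000 in
/-- If `g ∈ GL₄(k)` satisfies `rank(g − μ·1) ≥ 2` for every `μ ∈ k^×`, then for some
`μ ∈ k^×` the matrix `μ⁻¹·g` is conjugate to a Jordan-type matrix `x` satisfying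
conditions (a) and (b) of the twisted-cubic moving lemma. -/
theorem stmt_9 {k : Type*} [Field k] [IsAlgClosed k]
    (g : Matrix.GeneralLinearGroup (Fin 4) k)
    (hg : ∀ μ : k, μ ≠ 0 → 2 ≤ ((g : Matrix (Fin 4) (Fin 4) k) - μ • 1).rank) :
    ∃ μ : k, μ ≠ 0 ∧ ∃ a b c α β γ : k,
      (a = 0 ∨ a = 1) ∧ (b = 0 ∨ b = 1) ∧ (c = 0 ∨ c = 1) ∧
      α ≠ 0 ∧ β ≠ 0 ∧ γ ≠ 0 ∧ (β = γ → c = 1) ∧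
      (a ≠ 0 ∨ b ≠ 0 ∨ α ≠ 1 ∨ β ≠ 1) ∧
      ∃ P : Matrix.GeneralLinearGroup (Fin 4) k,
        μ⁻¹ • (g : Matrix (Fin 4) (Fin 4) k) =
          (P : Matrix (Fin 4) (Fin 4) k) *
            !![(1 : k),0,0,0; a,α,0,0; 0,b,β,0; 0,0,c,γ] *
            ((P⁻¹ : Matrix.GeneralLinearGroup (Fin 4) k) : Matrix (Fin 4) (Fin 4) k) := by
  obtain ⟨ι, _, l, e, u, hu_succ, hu_zero, hcard, hli⟩ :=
    Module.End.exists_jordan_chains (Matrix.mulVecLin (g : Matrix (Fin 4) (Fin 4) k))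
  set T := Matrix.mulVecLin (g : Matrix (Fin 4) (Fin 4) k) with hT
  rw [Module.finrank_fin_fun] at hcard
  have hu_indep (f : Fin 4 → ι × ℕ) (hf : Function.Injective f) (hfe : ∀ j, (f j).2 < e (f j).1) :
      LinearIndependent k fun j => u (f j).1 (f j).2 := by
    have hinj : Function.Injective fun j => (⟨(f j).1, (f j).2, hfe j⟩ : Σ i, Fin (e i)) := by
      intro j j' h
      exact hf (congrArg (fun x : Σ i, Fin (e i) => (x.1, (x.2 : ℕ))) h)
    exact hli.comp _ hinj
  have hl (i : ι) (hi : 0 < e i) : l i ≠ 0 := by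
    intro h
    obtain ⟨n, hn⟩ := Nat.exists_eq_succ_of_ne_zero hi.ne'
    have h0 : T (u i n) = 0 := by rw [hu_succ, h, ← Nat.succ_eq_add_one, ← hn, hu_zero]; simp
    have hinj : Function.Injective T := Matrix.mulVec_injective_of_isUnit g.isUnit
    exact hli.ne_zero ⟨i, n, by omega⟩ (hinj (h0.trans (map_zero T).symm))
  have hrank (f : Fin 4 → ι × ℕ) (hf : Function.Injective f) (hfe : ∀ j, (f j).2 < e (f j).1)
      (μ : k) (hμ : μ ≠ 0) (j₀ : Fin 4)
      (h : ∀ j ≠ j₀, l (f j).1 = μ ∧ e (f j).1 = (f j).2 + 1) : False := by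
    have := Matrix.rank_le_one_of_mulVec_eq_zero ((g : Matrix (Fin 4) (Fin 4) k) - μ • 1) _
      (hu_indep f hf hfe) j₀ fun j hj => by
        have h1 := hu_succ (f j).1 (f j).2
        rw [← (h j hj).2, hu_zero, (h j hj).1] at h1
        simpa [Matrix.sub_mulVec, Matrix.smul_mulVec, hT, sub_eq_zero] using h1
    have := hg μ hμ
    omega
  have key (f : Fin 4 → ι × ℕ) (hf : Function.Injective f) (hfe : ∀ j, (f j).2 < e (f j).1)
      (a b c : k) (ha : a = 0 ∨ a = 1) (hb : b = 0 ∨ b = 1) (hc : c = 0 ∨ c = 1)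
      (h0 : u (f 0).1 ((f 0).2 + 1) = a • u (f 1).1 (f 1).2)
      (h1 : u (f 1).1 ((f 1).2 + 1) = b • u (f 2).1 (f 2).2)
      (h2 : u (f 2).1 ((f 2).2 + 1) = c • u (f 3).1 (f 3).2)
      (h3 : e (f 3).1 = (f 3).2 + 1)
      (hc' : l (f 2).1 = l (f 3).1 → c = 1)
      (hab : a ≠ 0 ∨ b ≠ 0 ∨ l (f 1).1 ≠ l (f 0).1 ∨ l (f 2).1 ≠ l (f 0).1) :
      ∃ μ : k, μ ≠ 0 ∧ ∃ a b c α β γ : k,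
        (a = 0 ∨ a = 1) ∧ (b = 0 ∨ b = 1) ∧ (c = 0 ∨ c = 1) ∧
        α ≠ 0 ∧ β ≠ 0 ∧ γ ≠ 0 ∧ (β = γ → c = 1) ∧
        (a ≠ 0 ∨ b ≠ 0 ∨ α ≠ 1 ∨ β ≠ 1) ∧
        ∃ P : Matrix.GeneralLinearGroup (Fin 4) k,
          μ⁻¹ • (g : Matrix (Fin 4) (Fin 4) k) =
            (P : Matrix (Fin 4) (Fin 4) k) *
              !![(1 : k),0,0,0; a,α,0,0; 0,b,β,0; 0,0,c,γ] *
              ((P⁻¹ : Matrix.GeneralLinearGroup (Fin 4) k) : Matrix (Fin 4) (Fin 4) k) := by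
    have hne (j : Fin 4) : l (f j).1 ≠ 0 := hl _ (Nat.zero_lt_of_lt (hfe j))
    refine ⟨l (f 0).1, hne 0, a, b, c, (l (f 0).1)⁻¹ * l (f 1).1, (l (f 0).1)⁻¹ * l (f 2).1,
      (l (f 0).1)⁻¹ * l (f 3).1, ha, hb, hc, by simp [hne], by simp [hne], by simp [hne],
      fun h => hc' (mul_left_cancel₀ (inv_ne_zero (hne 0)) h), ?_,
      Matrix.exists_inv_smul_eq_conj_bidiagonal _ _ (hu_indep f hf hfe) (fun j => l (f j).1) (hne 0)
        a b c ?_ ?_ ?_ ?_⟩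
    · simpa [inv_mul_eq_one₀ (hne 0), eq_comm] using hab
    · exact h0 ▸ hu_succ _ _
    · exact h1 ▸ hu_succ _ _
    · exact h2 ▸ hu_succ _ _
    · exact (hu_succ _ _).trans (by rw [← h3, hu_zero, add_zero])
  classical
  have hpos (s : Finset ι) (hs : 0 < ∑ i ∈ s, e i) :
      ∃ i ∈ s, 0 < e i ∧ e i + ∑ j ∈ s.erase i, e j = ∑ j ∈ s, e j := by
    obtain ⟨i, hi, h⟩ := Finset.exists_ne_zero_of_sum_ne_zero hs.ne'
    exact ⟨i, hi, Nat.pos_of_ne_zero h, Finset.add_sum_erase s e hi⟩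
  have hle (i : ι) : e i + ∑ j ∈ Finset.univ.erase i, e j = 4 := by
    rw [Finset.add_sum_erase _ e (Finset.mem_univ i), hcard]
  by_cases h4 : ∃ i, 4 ≤ e i
  · obtain ⟨i, hi⟩ := h4
    have hi4 : e i = 4 := by have := hle i; omega
    refine key ![(i, 0), (i, 1), (i, 2), (i, 3)] ?_ ?_ 1 1 1 (.inr rfl) (.inr rfl) (.inr rfl)
      ?_ ?_ ?_ ?_ ?_ ?_
    · simp [Matrix.injective_vecCons_four]
    · simp [Fin.forall_fin_succ, hi4]
    all_goals simp [hi4]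
  by_cases h3 : ∃ i, e i = 3
  · obtain ⟨i, hi⟩ := h3
    have h := hle i
    obtain ⟨j, hj, hj0, hsum⟩ := hpos (Finset.univ.erase i) (by omega)
    have hji := Finset.ne_of_mem_erase hj
    have hj1 : e j = 1 := by omega
    have hu : u j 1 = 0 := hj1 ▸ hu_zero j
    refine key ![(j, 0), (i, 0), (i, 1), (i, 2)] ?_ ?_ 0 1 1 (.inl rfl) (.inr rfl) (.inr rfl)
      ?_ ?_ ?_ ?_ ?_ ?_
    · simp [Matrix.injective_vecCons_four, hji]
    · simp [Fin.forall_fin_succ, hi, hj1]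
    all_goals simp [hi, hu]
  by_cases h2 : ∃ i, e i = 2
  · obtain ⟨i, hi⟩ := h2
    have h := hle i
    have hui : u i 2 = 0 := hi ▸ hu_zero i
    obtain ⟨j, hj, hj0, hsum⟩ := hpos (Finset.univ.erase i) (by omega)
    have hji := Finset.ne_of_mem_erase hj
    obtain hj2 | hj1 : e j = 2 ∨ e j = 1 := by omega
    · refine key ![(i, 0), (i, 1), (j, 0), (j, 1)] ?_ ?_ 1 0 1 (.inr rfl) (.inl rfl) (.inr rfl)
        ?_ ?_ ?_ ?_ ?_ ?_
      · simp [Matrix.injective_vecCons_four, hji.symm]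
      · simp [Fin.forall_fin_succ, hi, hj2]
      all_goals simp [hj2, hui]
    obtain ⟨m, hm, hm0, hsum'⟩ := hpos ((Finset.univ.erase i).erase j) (by omega)
    have hmj := Finset.ne_of_mem_erase hm
    have hmi := Finset.ne_of_mem_erase (Finset.mem_of_mem_erase hm)
    have hm1 : e m = 1 := by omega
    have huj : u j 1 = 0 := hj1 ▸ hu_zero j
    have hum : u m 1 = 0 := hm1 ▸ hu_zero m
    by_cases hjm : l j = l m
    · by_cases hij : l i = l j
      · refine (hrank ![(i, 0), (i, 1), (j, 0), (m, 0)] ?_ ?_ (l i) (hl i (by omega)) 0 ?_).elim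
        · simp [Matrix.injective_vecCons_four, hji.symm, hmi.symm, hmj.symm]
        · simp [Fin.forall_fin_succ, hi, hj1, hm1]
        · simp [Fin.forall_fin_succ, hi, hj1, hm1, ← hjm, hij]
      refine key ![(j, 0), (i, 0), (i, 1), (m, 0)] ?_ ?_ 0 1 0 (.inl rfl) (.inr rfl) (.inl rfl)
        ?_ ?_ ?_ ?_ ?_ ?_
      · simp [Matrix.injective_vecCons_four, hji, hmi.symm, hmj.symm]
      · simp [Fin.forall_fin_succ, hi, hj1, hm1]
      all_goals simp [huj, hui, hm1, ← hjm, hij]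
    refine key ![(i, 0), (i, 1), (j, 0), (m, 0)] ?_ ?_ 1 0 0 (.inr rfl) (.inl rfl) (.inl rfl)
      ?_ ?_ ?_ ?_ ?_ ?_
    · simp [Matrix.injective_vecCons_four, hji.symm, hmi.symm, hmj.symm]
    · simp [Fin.forall_fin_succ, hi, hj1, hm1]
    all_goals simp [huj, hui, hm1, hjm]
  push Not at h4 h3 h2
  have hle1 (i : ι) : e i ≤ 1 := by
    have := h4 i; have := h3 i; have := h2 i; omega
  obtain ⟨p, hp, hp1⟩ : ∃ p : Fin 4 → ι, Function.Injective p ∧ ∀ j, e (p j) = 1 := by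
    have hs : (Finset.univ.filter fun i => e i = 1).card = 4 := by
      rw [Finset.card_filter, ← hcard]
      refine Finset.sum_congr rfl fun i _ => ?_
      have := hle1 i
      split_ifs <;> omega
    let q := (Finset.equivFinOfCardEq hs).symm
    exact ⟨fun j => q j, Subtype.val_injective.comp q.injective,
      fun j => (Finset.mem_filter.mp (q j).2).2⟩
  have hup (j : Fin 4) : u (p j) 1 = 0 := hp1 j ▸ hu_zero (p j)
  have hinj (σ : Fin 4 → Fin 4) (hσ : Function.Injective σ) :
      Function.Injective fun j => (p (σ j), 0) := fun j j' h => hσ (hp (congrArg Prod.fst h))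
  by_contra hcon
  have hdiag (σ : Fin 4 → Fin 4) (hσ : Function.Injective σ)
      (h23 : l (p (σ 2)) ≠ l (p (σ 3))) :
      l (p (σ 1)) = l (p (σ 0)) ∧ l (p (σ 2)) = l (p (σ 0)) := by
    by_contra h
    refine hcon (key (fun j => (p (σ j), 0)) (hinj σ hσ) (by simp [hp1]) 0 0 0 (.inl rfl) (.inl rfl)
      (.inl rfl) ?_ ?_ ?_ ?_ ?_ ?_)
    all_goals simp [hup, hp1, h23]
    tauto
  have heq (σ : Fin 4 → Fin 4) (hσ : Function.Injective σ) : l (p (σ 2)) = l (p (σ 3)) := by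
    by_contra h
    refine h ((hdiag σ hσ h).2.trans (hdiag (σ ∘ Equiv.swap 2 3)
      (hσ.comp (Equiv.injective _)) (Ne.symm h)).2.symm)
  have h12 := heq ![0, 3, 1, 2] (by decide)
  have h23 := heq id Function.injective_id
  refine hrank (fun j => (p j, 0)) (hinj id Function.injective_id) (by simp [hp1]) (l (p 1))
    (hl _ (by simp [hp1])) 0 ?_
  simp_all [Fin.forall_fin_succ]
end

section
/- Let k be an algebraically closed field and let Y ⊆ ℙ³(k) be the twisted cubic. Set Z_Y := {g ∈ GL₄(k) : g·Y ∩ Y ≠ ∅} and Z_Y° := ⋂_{g ∈ GL₄(k)} g·Z_Y·g⁻¹. Then Z_Y° = {g ∈ GL₄(k) : there exists μ ∈ k ∖ {0} with rank(g − μ·1) ≤ 1}, where 1 is the identity matrix. -/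
open Module Polynomial

section TwistedCubic

variable {k V : Type*} [Field k] [AddCommGroup V] [Module k V]

/-- The point with parameters `(s, t)` on the affine cone of the twisted cubic with respect to the
frame `e`. -/
def twistedCubicPoint (e : Fin 4 → V) (s t : k) : V :=
  s ^ 3 • e 0 + (s ^ 2 * t) • e 1 + (s * t ^ 2) • e 2 + t ^ 3 • e 3

/-- The frame `e` spans a twisted cubic which is disjoint from its image under `f`. -/
def MovesTwistedCubic (f : V →ₗ[k] V) (e : Fin 4 → V) : Prop :=
  LinearIndependent k e ∧ ∀ s t s' t' : k,
    f (twistedCubicPoint e s t) = twistedCubicPoint e s' t' → s = 0 ∧ t = 0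

theorem LinearIndependent.eq_of_eq_twistedCubicPoint {e : Fin 4 → V} (he : LinearIndependent k e)
    {a b c d s t : k} (h : a • e 0 + b • e 1 + c • e 2 + d • e 3 = twistedCubicPoint e s t) :
    a = s ^ 3 ∧ b = s ^ 2 * t ∧ c = s * t ^ 2 ∧ d = t ^ 3 := by
  have h' := Fintype.linearIndependent_iff.1 he
    ![a - s ^ 3, b - s ^ 2 * t, c - s * t ^ 2, d - t ^ 3] (by
      rw [twistedCubicPoint, ← sub_eq_zero] at h
      rw [← h, Fin.sum_univ_four]
      simp only [Matrix.cons_val]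
      module)
  exact ⟨sub_eq_zero.1 (h' 0), sub_eq_zero.1 (h' 1), sub_eq_zero.1 (h' 2), sub_eq_zero.1 (h' 3)⟩

theorem finite_setOf_pow_eq {n : ℕ} (hn : 0 < n) (a : k) : {x : k | x ^ n = a}.Finite := by
  refine (finite_setOfPred_isRoot (X_pow_sub_C_ne_zero hn a)).subset fun x hx => ?_
  simpa [sub_eq_zero] using hx

/-- The case in which `f` induces a scalar on the quotient by a plane of eigenvectors. -/
theorem exists_movesTwistedCubic_of_scalar [Infinite k] {f : V →ₗ[k] V} {a b : k} (hb : b ≠ 0)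
    {u : Fin 4 → V} (hu : LinearIndependent k u) (h0 : f (u 0) = b • u 0 + u 1)
    (h1 : f (u 1) = a • u 1) (h2 : f (u 2) = a • u 2) (h3 : f (u 3) = b • u 3 + u 2) :
    ∃ e : Fin 4 → V, MovesTwistedCubic f e := by
  obtain ⟨y, hy⟩ := (((finite_setOf_pow_eq three_pos (b ^ 3)).image
    fun P => (P - a) * P ^ 2 / b - a * (P - a)).insert 0).exists_notMem
  simp only [Set.mem_insert_iff, Set.mem_image, Set.mem_ofPred_eq, not_or, not_exists, not_and]
    at hy
  obtain ⟨hy0, hy⟩ := hy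
  have he : LinearIndependent k ![u 0, u 1, y⁻¹ • u 2, u 3] := by
    convert hu.units_smul ![1, 1, Units.mk0 y⁻¹ (inv_ne_zero hy0), 1] using 1
    ext i
    fin_cases i <;> simp [Units.smul_def]
  refine ⟨_, he, fun s t s' t' h => ?_⟩
  obtain ⟨e0, e1, e2, e3⟩ := he.eq_of_eq_twistedCubicPoint
    (a := b * s ^ 3) (b := a * (s ^ 2 * t) + s ^ 3) (c := a * (s * t ^ 2) + y * t ^ 3)
    (d := b * t ^ 3) (s := s') (t := t') (by
      rw [← h]
      simp only [twistedCubicPoint, Matrix.cons_val, map_add, map_smul, h0, h1, h2, h3]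
      match_scalars <;> field_simp
      ring)
  by_cases ht : t = 0
  · subst ht
    have : t' = 0 := by simpa using e3.symm
    subst this
    simpa using e1
  by_cases hs : s = 0
  · subst hs
    have : s' = 0 := by simpa using e0.symm
    subst this
    simp [hy0, ht] at e2
  exfalso
  obtain ⟨x, rfl⟩ : ∃ x, s = x * t := ⟨s / t, by field_simp⟩
  have hx : x ≠ 0 := by rintro rfl; simp at hs
  have q1 : (a + x) * (a * x + y) = b ^ 2 * x := by
    refine mul_left_cancel₀ (mul_ne_zero (pow_ne_zero 2 hx) (pow_ne_zero 6 ht)) ?_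
    linear_combination (a * (x * t * t ^ 2) + y * t ^ 3) * e1 + s' ^ 2 * t' * e2
      - b * t ^ 3 * e0 - s' ^ 3 * e3
  have q2 : b * (a * x + y) = x * (a + x) ^ 2 := by
    refine mul_left_cancel₀ (mul_ne_zero (pow_ne_zero 3 hx) (pow_ne_zero 6 ht)) ?_
    linear_combination (a * (x * t * t ^ 2) + y * t ^ 3) * e0 + s' ^ 3 * e2
      - (a * ((x * t) ^ 2 * t) + (x * t) ^ 3 + s' ^ 2 * t') * e1
  refine hy (a + x) (mul_left_cancel₀ hx ?_) ?_
  · linear_combination b * q1 - (a + x) * q2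
  · field_simp
    linear_combination -q2

/-- The case in which `f` does not induce a scalar on the quotient by a plane of eigenvectors. -/
theorem exists_movesTwistedCubic_of_nonscalar [Infinite k] {f : V →ₗ[k] V} {a B D : k}
    (ha : a ≠ 0) (hB : B ≠ 0) {u : Fin 4 → V} (hu : LinearIndependent k u)
    (h0 : f (u 0) = u 3 + u 2) (h1 : f (u 1) = a • u 1) (h2 : f (u 2) = a • u 2)
    (h3 : f (u 3) = B • u 0 + D • u 3 + u 1) :
    ∃ e : Fin 4 → V, MovesTwistedCubic f e := by
  have hp : C (-a ^ 3) * X ^ 6 + C (-3 * a ^ 2) * X ^ 4 + C (B ^ 2) * X ^ 3 + C (-3 * a) * X ^ 2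
      + C (B ^ 2 * D - 1) ≠ (0 : k[X]) := by
    intro h
    have := congrArg (coeff · 6) h
    norm_num [coeff_C_mul, coeff_X_pow, coeff_C, -map_pow, -map_mul, -map_neg, -map_sub] at this
    exact ha this
  obtain ⟨r, hr⟩ := ((finite_setOfPred_isRoot hp).image
    fun x => (a * x ^ 2 + 1) ^ 2 / B - a * x - x ^ 3).exists_notMem
  simp only [Set.mem_image, Set.mem_ofPred_eq, not_exists, not_and] at hr
  have he : LinearIndependent k ![u 0, u 1 - r • u 2, u 2, u 3] := by
    rw [Fintype.linearIndependent_iff] at hu ⊢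
    intro g hg
    have := hu ![g 0, g 1, g 2 - r * g 1, g 3] (by
      rw [← hg]
      simp only [Fin.sum_univ_four, Matrix.cons_val]
      module)
    have g1 : g 1 = 0 := this 1
    have g2 : g 2 - r * g 1 = 0 := this 2
    rw [g1, mul_zero, sub_zero] at g2
    intro i
    fin_cases i
    exacts [this 0, g1, g2, this 3]
  refine ⟨_, he, fun s t s' t' h => ?_⟩
  obtain ⟨e0, e1, e2, e3⟩ := he.eq_of_eq_twistedCubicPoint
    (a := B * t ^ 3) (b := a * (s ^ 2 * t) + t ^ 3) (c := a * (s * t ^ 2) + s ^ 3 + r * t ^ 3)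
    (d := s ^ 3 + D * t ^ 3) (s := s') (t := t') (by
      rw [← h]
      simp only [twistedCubicPoint, Matrix.cons_val, map_add, map_sub, map_smul, h0, h1, h2, h3]
      module)
  by_cases ht : t = 0
  · subst ht
    have : s' = 0 := by simpa using e0.symm
    subst this
    simpa using e2
  exfalso
  obtain ⟨x, rfl⟩ : ∃ x, s = x * t := ⟨s / t, by field_simp⟩
  have q1 : B * (a * x + x ^ 3 + r) = (a * x ^ 2 + 1) ^ 2 := by
    refine mul_left_cancel₀ (pow_ne_zero 6 ht) ?_
    linear_combination (a * (x * t * t ^ 2) + (x * t) ^ 3 + r * t ^ 3) * e0 + s' ^ 3 * e2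
      - (a * ((x * t) ^ 2 * t) + t ^ 3 + s' ^ 2 * t') * e1
  have q2 : B ^ 2 * (x ^ 3 + D) = (a * x ^ 2 + 1) ^ 3 := by
    refine mul_left_cancel₀ (pow_ne_zero 9 ht) ?_
    have E0 : B ^ 2 * t ^ 6 = s' ^ 6 := by linear_combination (B * t ^ 3 + s' ^ 3) * e0
    have E1 : (a * ((x * t) ^ 2 * t) + t ^ 3) ^ 3 = (s' ^ 2 * t') ^ 3 := by rw [e1]
    linear_combination ((x * t) ^ 3 + D * t ^ 3) * E0 + s' ^ 6 * e3 - E1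
  refine hr x ?_ ?_
  · simp only [IsRoot, eval_add, eval_mul, eval_C, eval_pow, eval_X]
    linear_combination q2
  · field_simp
    linear_combination -q1

/-- The case in which `f` has a cyclic vector. -/
theorem exists_movesTwistedCubic_of_cyclic [Infinite k] (hV : finrank k V = 4) {f : V →ₗ[k] V}
    {v : V} (hv : ∀ W : Submodule k V, v ∈ W → (∀ w ∈ W, f w ∈ W) → W = ⊤) :
    ∃ e : Fin 4 → V, MovesTwistedCubic f e := by
  have : FiniteDimensional k V := FiniteDimensional.of_finrank_pos (by omega)
  obtain ⟨C0, C1, C2, C3, hC⟩ : ∃ C0 C1 C2 C3 : k,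
      f (f (f (f v))) = C0 • v + C1 • f v + C2 • f (f v) + C3 • f (f (f v)) := by
    have hd : f.charpoly.natDegree = 4 := by rw [LinearMap.charpoly_natDegree, hV]
    have hc : f.charpoly.coeff 4 = 1 := hd ▸ f.charpoly_monic.coeff_natDegree
    have h := LinearMap.congr_fun f.aeval_self_charpoly v
    rw [aeval_eq_sum_range, hd] at h
    simp [Finset.sum_range_succ, hc, pow_succ] at h
    refine ⟨-f.charpoly.coeff 0, -f.charpoly.coeff 1, -f.charpoly.coeff 2, -f.charpoly.coeff 3, ?_⟩
    rw [← sub_eq_zero, ← h]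
    module
  have hfin : {m : k | ∃ x : k, x ^ 5 = 1 ∧
      x ^ 2 * m ^ 4 = C0 * x ^ 2 + C1 * m * x ^ 3 + C2 * m ^ 2 * x + C3 * m ^ 3}.Finite := by
    have : {m : k | ∃ x : k, x ^ 5 = 1 ∧
      x ^ 2 * m ^ 4 = C0 * x ^ 2 + C1 * m * x ^ 3 + C2 * m ^ 2 * x + C3 * m ^ 3} =
      ⋃ x ∈ {x : k | x ^ 5 = 1}, {m : k |
        x ^ 2 * m ^ 4 = C0 * x ^ 2 + C1 * m * x ^ 3 + C2 * m ^ 2 * x + C3 * m ^ 3} := by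
      ext m; simp
    rw [this]
    refine (finite_setOf_pow_eq (by norm_num) 1).biUnion fun x hx => ?_
    have hp : C (x ^ 2) * X ^ 4 - C C3 * X ^ 3 - C (C2 * x) * X ^ 2 - C (C1 * x ^ 3) * X
        - C (C0 * x ^ 2) ≠ (0 : k[X]) := by
      intro h
      have := congrArg (coeff · 4) h
      norm_num [coeff_C_mul, coeff_X_pow, coeff_C, coeff_X, -map_pow, -map_mul] at this
      simp [this] at hx
    refine (finite_setOfPred_isRoot hp).subset fun m hm => ?_
    simp only [Set.mem_ofPred_eq, IsRoot, eval_sub, eval_mul, eval_C, eval_pow, eval_X] at hm ⊢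
    linear_combination hm
  obtain ⟨m, hm⟩ := (hfin.insert 0).exists_notMem
  simp only [Set.mem_insert_iff, Set.mem_ofPred_eq, not_or, not_exists, not_and] at hm
  obtain ⟨hm0, hm⟩ := hm
  obtain ⟨e, he⟩ : ∃ e : Fin 4 → V, e = ![m⁻¹ ^ 2 • (f (f v) - C3 • f v - C2 • v),
    m⁻¹ ^ 3 • (f (f (f v)) - C3 • f (f v) - C2 • f v - C1 • v), m⁻¹ • (f v - C3 • v), v] := ⟨_, rfl⟩
  have h0 : f (e 0) = m • e 1 + (C1 / m ^ 2) • e 3 := by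
    simp only [he, Matrix.cons_val, map_sub, map_smul]
    match_scalars <;> field_simp
    ring
  have h1 : f (e 1) = (C0 / m ^ 3) • e 3 := by
    simp only [he, Matrix.cons_val, map_sub, map_smul, hC]
    match_scalars <;> field_simp <;> ring
  have h2 : f (e 2) = m • e 0 + (C2 / m) • e 3 := by
    simp only [he, Matrix.cons_val, map_sub, map_smul]
    match_scalars <;> field_simp
    ring
  have h3 : f (e 3) = m • e 2 + C3 • e 3 := by
    simp only [he, Matrix.cons_val]
    match_scalars <;> field_simp
    ring
  have hmem (i) : e i ∈ Submodule.span k (Set.range e) := Submodule.subset_span ⟨i, rfl⟩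
  have hspan : Submodule.span k (Set.range e) = ⊤ := by
    refine hv _ (by simpa [he] using hmem 3) fun w hw => ?_
    induction hw using Submodule.span_induction with
    | zero => simp
    | add x y _ _ hx hy => rw [map_add]; exact add_mem hx hy
    | smul c x _ hx => rw [map_smul]; exact Submodule.smul_mem _ c hx
    | mem x hx =>
      have hsmul (c : k) (i) := Submodule.smul_mem _ c (hmem i)
      obtain ⟨i, rfl⟩ := hx
      fin_cases i
      · simpa only [Fin.zero_eta, h0] using add_mem (hsmul _ _) (hsmul _ _)
      · simpa only [Fin.mk_one, h1] using hsmul _ _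
      · simpa only [Fin.reduceFinMk, h2] using add_mem (hsmul _ _) (hsmul _ _)
      · simpa only [Fin.reduceFinMk, h3] using add_mem (hsmul _ _) (hsmul _ _)
  have hli : LinearIndependent k e :=
    linearIndependent_of_top_le_span_of_card_eq_finrank hspan.ge (by simp [hV])
  refine ⟨e, hli, fun s t s' t' h => ?_⟩
  obtain ⟨e0, e1, e2, e3⟩ := hli.eq_of_eq_twistedCubicPoint
    (a := m * (s * t ^ 2)) (b := m * s ^ 3) (c := m * t ^ 3)
    (d := C1 / m ^ 2 * s ^ 3 + C0 / m ^ 3 * (s ^ 2 * t) + C2 / m * (s * t ^ 2) + C3 * t ^ 3)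
    (s := s') (t := t') (by
      rw [← h]
      simp only [twistedCubicPoint, map_add, map_smul, h0, h1, h2, h3]
      module)
  by_cases hs : s = 0
  · subst hs
    have : s' = 0 := by simpa using e0.symm
    subst this
    simpa [hm0] using e2
  exfalso
  have hts : t ^ 5 = s ^ 5 := by
    refine mul_left_cancel₀ (mul_ne_zero (pow_ne_zero 2 hm0) hs) ?_
    linear_combination (m * t ^ 3) * e0 + s' ^ 3 * e2 - (m * s ^ 3 + s' ^ 2 * t') * e1
  have ht : t ≠ 0 := by
    rintro rfl
    exact hs (by simpa using hts.symm)
  obtain ⟨x, rfl⟩ : ∃ x, s = x * t := ⟨s / t, by field_simp⟩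
  have hx : x ≠ 0 := by rintro rfl; simp at hs
  refine hm x (mul_right_cancel₀ (pow_ne_zero 5 ht) ?_) ?_
  · linear_combination -hts
  · have e3' : C1 * m * x ^ 3 * t ^ 3 + C0 * x ^ 2 * t ^ 3 + C2 * m ^ 2 * x * t ^ 3
        + C3 * m ^ 3 * t ^ 3 = m ^ 3 * t' ^ 3 := by
      rw [← e3]
      field_simp
    refine mul_left_cancel₀ (mul_ne_zero (mul_ne_zero hm0 hx) (pow_ne_zero 6 ht)) ?_
    linear_combination m ^ 3 * ((m * t ^ 3) * e1 + s' ^ 2 * t' * e2) - m * x * t ^ 3 * e3'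
      - m ^ 3 * t' ^ 3 * e0

theorem LinearIndependent.vecCons_of_mkQ {K : Submodule k V} {x y z w : V}
    (hxw : LinearIndependent k ![K.mkQ x, K.mkQ w]) (hyz : LinearIndependent k ![y, z])
    (hy : y ∈ K) (hz : z ∈ K) : LinearIndependent k ![x, y, z, w] := by
  rw [LinearIndependent.pair_iff] at hxw hyz
  rw [Fintype.linearIndependent_iff]
  intro g hg
  simp only [Fin.sum_univ_four, Matrix.cons_val] at hg
  obtain ⟨g0, g3⟩ := hxw (g 0) (g 3) (by
    have := congrArg K.mkQ hg
    simpa [(Submodule.Quotient.mk_eq_zero K).2 hy, (Submodule.Quotient.mk_eq_zero K).2 hz]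
      using this)
  obtain ⟨g1, g2⟩ := hyz (g 1) (g 2) (by simpa [g0, g3] using hg)
  intro i
  fin_cases i
  exacts [g0, g1, g2, g3]

theorem exists_movesTwistedCubic_of_finrank_eigenspace_eq_two [Infinite k] (hV : finrank k V = 4)
    {f : End k V} (hf : Function.Injective f) {a : k} (ha : finrank k (f.eigenspace a) = 2) :
    ∃ e : Fin 4 → V, MovesTwistedCubic f e := by
  have : FiniteDimensional k V := FiniteDimensional.of_finrank_pos (by omega)
  have hsurj : Function.Surjective f := LinearMap.injective_iff_surjective.1 hf
  obtain ⟨K, hKa⟩ : ∃ K, K = f.eigenspace a := ⟨_, rfl⟩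
  have hK (x : V) : x ∈ K ↔ f x = a • x := by rw [hKa, End.mem_eigenspace_iff]
  rw [← hKa] at ha
  have hQ : finrank k (V ⧸ K) = 2 := by have := K.finrank_quotient_add_finrank; omega
  have hmk (x : V) : K.mkQ x = 0 ↔ x ∈ K := Submodule.Quotient.mk_eq_zero K
  obtain ⟨⟨κ, hκ⟩, hκ0⟩ : ∃ κ : K, κ ≠ 0 := by
    have := nontrivial_of_finrank_pos (R := k) (M := K) (by omega)
    exact exists_ne 0
  replace hκ0 : κ ≠ 0 := fun h => hκ0 (Subtype.ext h)
  have ha0 : a ≠ 0 := by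
    rintro rfl
    rw [hK, zero_smul] at hκ
    exact hκ0 (hf (by rw [hκ, map_zero]))
  have hpair {σ : V} (hσ : σ ∈ K) (hσ0 : σ ≠ 0) : ∃ z ∈ K, LinearIndependent k ![σ, z] := by
    obtain ⟨z, hz⟩ := exists_linearIndependent_pair_of_one_lt_finrank (R := k) (M := K)
      (by omega) (x := ⟨σ, hσ⟩) (fun h => hσ0 (congrArg Subtype.val h))
    refine ⟨z, z.2, ?_⟩
    rw [LinearIndependent.pair_iff] at hz ⊢
    exact fun s t h => hz s t (Subtype.ext h)
  by_cases hsc : ∃ b : k, ∀ x, f x - b • x ∈ K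
  · obtain ⟨b, hb⟩ := hsc
    have hb0 : b ≠ 0 := by
      rintro rfl
      have : K = ⊤ := by
        rw [eq_top_iff]
        intro y _
        obtain ⟨x, rfl⟩ := hsurj y
        simpa using hb x
      rw [this, finrank_top] at ha
      omega
    obtain ⟨z, hz, hκz⟩ := hpair hκ hκ0
    let q := finBasisOfFinrankEq k (V ⧸ K) hQ
    obtain ⟨x, hx⟩ := K.mkQ_surjective (q 0)
    obtain ⟨w, hw⟩ := K.mkQ_surjective (q 1)
    have hxw : LinearIndependent k ![K.mkQ x, K.mkQ w] := by
      convert q.linearIndependent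
      ext i
      fin_cases i <;> simp [hx, hw]
    obtain ⟨x', w', hx', hxw', hI⟩ : ∃ x' w' : V, K.mkQ x' = K.mkQ x ∧ K.mkQ w' = K.mkQ w ∧
        LinearIndependent k ![f x' - b • x', f w' - b • w'] := by
      by_cases hab : a = b
      · subst hab
        refine ⟨x, w, rfl, rfl, ?_⟩
        rw [LinearIndependent.pair_iff] at hxw ⊢
        intro s t h
        refine hxw s t ?_
        rw [← map_smul, ← map_smul, ← map_add, hmk, hK, ← sub_eq_zero, ← h]
        simp only [map_add, map_smul]
        module
      · have hshift (x y : V) (hy : y ∈ K) :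
            ∃ x', K.mkQ x' = K.mkQ x ∧ f x' - b • x' = y := by
          have h := K.smul_mem (a - b)⁻¹ (sub_mem hy (hb x))
          refine ⟨x + (a - b)⁻¹ • (y - (f x - b • x)), ?_, ?_⟩
          · rw [map_add, (hmk _).2 h, add_zero]
          · rw [map_add, (hK _).1 h]
            have : a - b ≠ 0 := sub_ne_zero.2 hab
            match_scalars <;> field_simp <;> ring
        obtain ⟨x', h1, h2⟩ := hshift x κ hκ
        obtain ⟨w', h3, h4⟩ := hshift w z hz
        exact ⟨x', w', h1, h3, by rwa [h2, h4]⟩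
    rw [← hx', ← hxw'] at hxw
    refine exists_movesTwistedCubic_of_scalar (a := a) hb0 (hxw.vecCons_of_mkQ hI (hb _) (hb _))
      ?_ ?_ ?_ ?_
    · simp
    · simpa using (hK _).1 (hb x')
    · simpa using (hK _).1 (hb w')
    · simp
  · have hKf : K ≤ K.comap f := fun x hx => by
      rw [Submodule.mem_comap, (hK x).1 hx]
      exact K.smul_mem _ hx
    obtain ⟨x, hx⟩ : ∃ x, LinearIndependent k ![K.mkQ x, K.mkQ (f x)] := by
      by_contra! h
      obtain ⟨b, hb⟩ := LinearMap.exists_eq_smul_id_of_forall_notLinearIndependent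
        (f := K.mapQ K f hKf) fun y => by
          obtain ⟨x, rfl⟩ := K.mkQ_surjective y
          exact h x
      refine hsc ⟨b, fun x => ?_⟩
      have := LinearMap.congr_fun hb (K.mkQ x)
      rw [← hmk, map_sub, map_smul, sub_eq_zero]
      exact this
    obtain ⟨B, D, hBD⟩ : ∃ B D : k, B • K.mkQ x + D • K.mkQ (f x) = K.mkQ (f (f x)) := by
      have := hx.span_eq_top_of_card_eq_finrank' (by simp [hQ])
      rw [← Submodule.mem_span_pair]
      simpa [Set.pair_comm] using this.ge (Submodule.mem_top (x := K.mkQ (f (f x))))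
    have hσ : f (f x) - B • x - D • f x ∈ K := by
      rw [← hmk, map_sub, map_sub, map_smul, map_smul, ← hBD]
      abel
    have hind : ∀ c : k, f x - c • x ∉ K := by
      intro c hc
      rw [← hmk, map_sub, map_smul] at hc
      have := (LinearIndependent.pair_iff.1 hx (-c) 1 (by rw [← hc]; module)).2
      exact one_ne_zero this
    have hB : B ≠ 0 := by
      rintro rfl
      refine hind D ?_
      have h := (hK _).1 hσ
      have : f x - D • x = a⁻¹ • (f (f x) - (0 : k) • x - D • f x) := by
        refine hf ?_
        rw [map_smul, h, smul_smul, inv_mul_cancel₀ ha0, map_sub, map_smul]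
        simp
      rw [this]
      exact K.smul_mem _ hσ
    obtain ⟨x, hx, hσ, hσ0⟩ : ∃ x, LinearIndependent k ![K.mkQ x, K.mkQ (f x)] ∧
        f (f x) - B • x - D • f x ∈ K ∧ f (f x) - B • x - D • f x ≠ 0 := by
      by_cases hσ0 : f (f x) - B • x - D • f x = 0
      · by_cases hq : a ^ 2 - D * a - B = 0
        · refine absurd ?_ (hind (D - a))
          rw [hK, ← sub_eq_zero, ← hσ0, map_sub, map_smul, ← sub_eq_zero.1 hq]
          module
        · have hfκ := (hK _).1 hκ
          have hval : f (f (x + κ)) - B • (x + κ) - D • f (x + κ) = (a ^ 2 - D * a - B) • κ := by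
            rw [← add_zero ((a ^ 2 - D * a - B) • κ), ← hσ0]
            simp only [map_add, map_smul, hfκ]
            module
          refine ⟨x + κ, ?_, ?_, ?_⟩
          · rwa [map_add, map_add, map_add, hfκ, map_smul, (hmk _).2 hκ, smul_zero, add_zero,
              add_zero]
          · rw [hval]
            exact K.smul_mem _ hκ
          · rw [hval]
            exact smul_ne_zero hq hκ0
      · exact ⟨x, hx, hσ, hσ0⟩
    obtain ⟨z, hz, hσz⟩ := hpair hσ hσ0
    have hy := add_mem hσ (K.smul_mem (D - a) hz)
    have hu : LinearIndependent k
        ![x, f (f x) - B • x - D • f x + (D - a) • z, z, f x - z] := by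
      refine LinearIndependent.vecCons_of_mkQ (K := K) ?_ ?_ hy hz
      · rwa [map_sub, (hmk z).2 hz, sub_zero]
      · rw [LinearIndependent.pair_iff] at hσz ⊢
        intro s t h
        obtain ⟨hs, ht⟩ := hσz s (s * (D - a) + t) (by rw [← h]; module)
        simpa [hs] using ht
    refine exists_movesTwistedCubic_of_nonscalar ha0 hB (D := D) hu ?_ ?_ ?_ ?_
    · simp
    · simpa only [Matrix.cons_val] using (hK _).1 hy
    · simpa using (hK _).1 hz
    · simp only [Matrix.cons_val, map_sub, (hK _).1 hz]
      module

theorem exists_cyclic_vector_of_finrank_eigenspace_le_one [IsAlgClosed k] [FiniteDimensional k V]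
    {f : End k V} (hf : ∀ a : k, finrank k (f.eigenspace a) ≤ 1) :
    ∃ v, ∀ W : Submodule k V, v ∈ W → (∀ w ∈ W, f w ∈ W) → W = ⊤ := by
  classical
  have : Infinite k := IsAlgClosed.instInfinite
  let s : Finset (Submodule k V) :=
    f.finite_hasEigenvalue.toFinset.image fun a => LinearMap.range (f - a • 1)
  have hs : ⊤ ∉ s := by
    simp only [s, Finset.mem_image, Set.Finite.mem_toFinset, not_exists, not_and]
    intro a (ha : f.HasEigenvalue a) h
    rw [LinearMap.range_eq_top, ← LinearMap.injective_iff_surjective, ← LinearMap.ker_eq_bot,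
      ← End.eigenspace_def] at h
    exact End.hasEigenvalue_iff.1 ha h
  obtain ⟨v, hv⟩ := (Set.ne_univ_iff_exists_notMem _).1 (Subspace.biUnion_ne_univ_of_top_notMem hs)
  refine ⟨v, fun W hvW hW => ?_⟩
  by_contra hWtop
  have : Nontrivial (V ⧸ W) := Submodule.Quotient.nontrivial_iff.2 hWtop
  obtain ⟨a, ha⟩ := End.exists_eigenvalue (W.mapQ W f hW)
  have hsup : W ⊔ LinearMap.range (f - a • 1) ≠ ⊤ := by
    intro h
    refine End.hasEigenvalue_iff.1 ha ?_
    rw [End.eigenspace_def, LinearMap.ker_eq_bot, LinearMap.injective_iff_surjective]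
    intro y
    obtain ⟨y, rfl⟩ := W.mkQ_surjective y
    obtain ⟨w, hw, _, ⟨x, rfl⟩, rfl⟩ := Submodule.mem_sup.1 (h.ge (Submodule.mem_top (x := y)))
    refine ⟨W.mkQ x, ?_⟩
    rw [map_add, show W.mkQ w = 0 from (Submodule.Quotient.mk_eq_zero W).2 hw, zero_add]
    rfl
  have hlt := Submodule.finrank_lt hsup
  have hker := LinearMap.finrank_range_add_finrank_ker (f - a • 1)
  have hle := hf a
  rw [End.eigenspace_def] at hle
  have heq := Submodule.eq_of_le_of_finrank_le
    (le_sup_right : LinearMap.range (f - a • 1) ≤ W ⊔ LinearMap.range (f - a • 1)) (by omega)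
  refine hv ?_
  simp only [s, Finset.mem_image, Set.Finite.mem_toFinset, Set.mem_iUnion]
  refine ⟨_, ⟨a, ?_, rfl⟩, heq ▸ Submodule.mem_sup_left hvW⟩
  refine End.hasEigenvalue_iff.2 fun h => hsup ?_
  rw [End.eigenspace_def, LinearMap.ker_eq_bot, LinearMap.injective_iff_surjective,
    ← LinearMap.range_eq_top] at h
  rw [← heq, h]

theorem exists_movesTwistedCubic [IsAlgClosed k] (hV : finrank k V = 4) {f : End k V}
    (hf : Function.Injective f) (h : ∀ a ≠ 0, finrank k (f.eigenspace a) ≤ 2) :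
    ∃ e : Fin 4 → V, MovesTwistedCubic f e := by
  have : FiniteDimensional k V := FiniteDimensional.of_finrank_pos (by omega)
  have : Infinite k := IsAlgClosed.instInfinite
  by_cases hc : ∀ a, finrank k (f.eigenspace a) ≤ 1
  · obtain ⟨v, hv⟩ := exists_cyclic_vector_of_finrank_eigenspace_le_one hc
    exact exists_movesTwistedCubic_of_cyclic hV hv
  · push Not at hc
    obtain ⟨a, ha⟩ := hc
    have ha0 : a ≠ 0 := by
      rintro rfl
      rw [End.eigenspace_zero, LinearMap.ker_eq_bot.2 hf, finrank_bot] at ha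
      omega
    exact exists_movesTwistedCubic_of_finrank_eigenspace_eq_two hV hf
      (le_antisymm (h a ha0) ha)

/-- A linear map of rank at most one vanishes at some point of a twisted cubic. -/
theorem exists_map_twistedCubicPoint_eq_zero [IsAlgClosed k] {W : Type*} [AddCommGroup W]
    [Module k W] [FiniteDimensional k W] (φ : V →ₗ[k] W)
    (hφ : finrank k (LinearMap.range φ) ≤ 1) (e : Fin 4 → V) :
    ∃ s t : k, (s ≠ 0 ∨ t ≠ 0) ∧ φ (twistedCubicPoint e s t) = 0 := by
  obtain ⟨u, hu⟩ := finrank_le_one_iff.1 hφ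
  have hu' (x : V) : ∃ c : k, φ x = c • (u : W) := by
    obtain ⟨c, hc⟩ := hu ⟨φ x, LinearMap.mem_range_self φ x⟩
    exact ⟨c, (congrArg Subtype.val hc).symm⟩
  choose c hc using hu'
  have key (s t : k) : φ (twistedCubicPoint e s t) =
      (c (e 0) * s ^ 3 + c (e 1) * s ^ 2 * t + c (e 2) * s * t ^ 2 + c (e 3) * t ^ 3) •
        (u : W) := by
    simp only [twistedCubicPoint, map_add, map_smul, hc (e _)]
    module
  by_cases h0 : c (e 0) = 0
  · exact ⟨1, 0, by simp, by simp [key, h0]⟩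
  · obtain ⟨s, hs⟩ := IsAlgClosed.exists_root
      (C (c (e 0)) * X ^ 3 + C (c (e 1)) * X ^ 2 + C (c (e 2)) * X + C (c (e 3)))
      (by rw [degree_cubic h0]; decide)
    refine ⟨s, 1, by simp, ?_⟩
    rw [key]
    simp only [IsRoot, eval_add, eval_mul, eval_C, eval_pow, eval_X] at hs
    simp [hs]

end TwistedCubic

theorem Matrix.mulVec_twistedCubic {k : Type*} [Field k] (A : Matrix (Fin 4) (Fin 4) k) (s t : k) :
    A.mulVec ![s ^ 3, s ^ 2 * t, s * t ^ 2, t ^ 3] = twistedCubicPoint A.col s t := by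
  ext i
  simp [twistedCubicPoint, Matrix.mulVec, dotProduct, Fin.sum_univ_four]
  ring


/-- The core of the intersection obstruction of the twisted cubic `Y ⊆ ℙ³(k)` is
`Z_Y° = {g ∈ GL₄(k) : rank(g − μ·1) ≤ 1 for some μ ∈ k^×}`.  Here `Z_Y` is described via
the affine cone `{(s³, s²t, st², t³)}` of the twisted cubic. -/
theorem stmt_10 {k : Type*} [Field k] [IsAlgClosed k] :
    (⋂ g : Matrix.GeneralLinearGroup (Fin 4) k,
        (fun z => g * z * g⁻¹) ''
          {z : Matrix.GeneralLinearGroup (Fin 4) k |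
            ∃ v : Fin 4 → k, v ≠ 0 ∧
              (∃ s t : k, v = ![s ^ 3, s ^ 2 * t, s * t ^ 2, t ^ 3]) ∧
              (∃ s t : k,
                ((z⁻¹ : Matrix.GeneralLinearGroup (Fin 4) k) :
                    Matrix (Fin 4) (Fin 4) k).mulVec v =
                  ![s ^ 3, s ^ 2 * t, s * t ^ 2, t ^ 3])}) =
      {g : Matrix.GeneralLinearGroup (Fin 4) k |
        ∃ μ : k, μ ≠ 0 ∧ ((g : Matrix (Fin 4) (Fin 4) k) - μ • 1).rank ≤ 1} := by
  ext g
  simp only [Set.mem_iInter, Set.mem_image, Set.mem_ofPred_eq]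
  constructor
  · intro hg
    by_contra! hrank
    have hinj : Function.Injective (Matrix.mulVecLin (g : Matrix (Fin 4) (Fin 4) k)) :=
      Matrix.mulVec_injective_of_isUnit g.isUnit
    obtain ⟨e, he, hmove⟩ := exists_movesTwistedCubic (by simp) (f := Matrix.mulVecLin g.val) hinj
      fun a ha => by
        have h1 := hrank a ha
        have h2 := LinearMap.finrank_range_add_finrank_ker (Matrix.mulVecLin (g.val - a • 1))
        have h3 : Matrix.mulVecLin (g.val - a • 1) = Matrix.mulVecLin g.val - a • 1 := by
          refine LinearMap.ext fun x => ?_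
          rw [LinearMap.sub_apply, Matrix.mulVecLin_apply, Matrix.mulVecLin_apply,
            Matrix.sub_mulVec, Matrix.smul_mulVec, Matrix.one_mulVec]
          rfl
        rw [Module.End.eigenspace_def, ← h3]
        rw [Module.finrank_fin_fun] at h2
        rw [Matrix.rank] at h1
        omega
    have hunit : IsUnit (Matrix.of fun i j => e j i) :=
      Matrix.linearIndependent_cols_iff_isUnit.1 he
    obtain ⟨h, hh⟩ := hunit
    have hcol : h.val.col = e := by rw [hh]; rfl
    obtain ⟨z, ⟨v, hv0, ⟨s, t, hv⟩, s', t', hw⟩, hz⟩ := hg h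
    obtain ⟨rfl, rfl⟩ := hmove s' t' s t (by
      rw [← hcol, ← Matrix.mulVec_twistedCubic, ← Matrix.mulVec_twistedCubic, ← hv, ← hw,
        Matrix.mulVecLin_apply, Matrix.mulVec_mulVec, Matrix.mulVec_mulVec, ← Units.val_mul,
        ← Units.val_mul, ← hz]
      simp)
    refine hv0 (Matrix.mulVec_injective_of_isUnit (z⁻¹).isUnit ?_)
    rw [hw, Matrix.mulVec_zero]
    ext i
    fin_cases i <;> simp
  · rintro ⟨μ, hμ, hrank⟩ h
    rw [Matrix.rank] at hrank
    obtain ⟨s, t, hst, hφ⟩ := exists_map_twistedCubicPoint_eq_zero _ hrank h.val.col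
    obtain ⟨c, hc⟩ := IsAlgClosed.exists_pow_nat_eq μ⁻¹ three_pos
    have hev : g.val.mulVec (h.val.mulVec ![s ^ 3, s ^ 2 * t, s * t ^ 2, t ^ 3]) =
        μ • h.val.mulVec ![s ^ 3, s ^ 2 * t, s * t ^ 2, t ^ 3] := by
      rw [← Matrix.mulVec_twistedCubic] at hφ
      simpa [Matrix.sub_mulVec, Matrix.smul_mulVec, sub_eq_zero] using hφ
    refine ⟨h⁻¹ * g * h, ⟨_, fun h0 => ?_, ⟨s, t, rfl⟩, c * s, c * t, ?_⟩, by group⟩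
    · have hs := congrFun h0 0
      have ht := congrFun h0 3
      simp at hs ht
      simp [hs, ht] at hst
    · refine Matrix.mulVec_injective_of_isUnit (h⁻¹ * g * h).isUnit ?_
      have hcv : ![(c * s) ^ 3, (c * s) ^ 2 * (c * t), c * s * (c * t) ^ 2, (c * t) ^ 3] =
          μ⁻¹ • ![s ^ 3, s ^ 2 * t, s * t ^ 2, t ^ 3] := by
        rw [← hc]
        ext i
        fin_cases i <;> simp <;> ring
      rw [Matrix.mulVec_mulVec, ← Units.val_mul, mul_inv_cancel, Units.val_one, Matrix.one_mulVec,
        hcv, Matrix.mulVec_smul, Units.val_mul, Units.val_mul, ← Matrix.mulVec_mulVec,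
        ← Matrix.mulVec_mulVec, hev, Matrix.mulVec_smul, Matrix.mulVec_mulVec, ← Units.val_mul,
        inv_mul_cancel, Units.val_one, Matrix.one_mulVec, smul_smul, inv_mul_cancel₀ hμ, one_smul]
end
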